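/- Let M be an abelian group such that the Tate module T_ℓM = lim_n Ker(ℓⁿ : M → M) vanishes for every prime ℓ, and such that the quotient M/nM is finite for every integer n ≥ 1. Then the first Ulm subgroup U(M) = ⋂_{n≥1} nM is uniquely divisible, i.e., it is divisible and torsion-free (equivalently, it carries the structure of a ℚ-vector space). -/

import Mathlib

/-- The subgroup `nM` of an abelian group `M` (the range of multiplication by `n`). -/
def nsmulSub (M : Type*) [AddCommGroup M] (n : ℕ) : AddSubgroup M :=
  AddMonoidHom.range (n • AddMonoidHom.id M)

/-- The first Ulm subgroup `U(M) = ⋂_{n ≥ 1} nM` of an abelian group `M`. -/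
def ulmSub (M : Type*) [AddCommGroup M] : AddSubgroup M :=
  ⨅ (n : ℕ) (_ : 1 ≤ n), nsmulSub M n

theorem mem_nsmulSub_aux {M : Type*} [AddCommGroup M] {n : ℕ} {x : M} :
    x ∈ nsmulSub M n ↔ ∃ y, n • y = x := by
  simp [nsmulSub, AddMonoidHom.mem_range]

theorem mem_ulmSub_aux {M : Type*} [AddCommGroup M] {x : M} :
    x ∈ ulmSub M ↔ ∀ n : ℕ, 1 ≤ n → ∃ y, n • y = x := by
  simp only [ulmSub, AddSubgroup.mem_iInf, mem_nsmulSub_aux]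

theorem tate_aux {M : Type*} [AddCommGroup M] (l : ℕ)
    (ht : ∀ x : ℕ → M,
      (∀ n : ℕ, (l ^ n) • x n = 0) → (∀ n : ℕ, l • x (n + 1) = x n) → ∀ n, x n = 0)
    (P : M → Prop) (hP : ∀ x, P x → ∃ y, P y ∧ l • y = x)
    (x : M) (hx : P x) (h0 : l • x = 0) : x = 0 := by
  choose! f hf using hP
  let t : ℕ → M := fun n => Nat.rec x (fun _ y => f y) n
  have t1 : ∀ n, t (n + 1) = f (t n) := fun n => rfl
  have hPt : ∀ n, P (t n) := by
    intro n
    induction n with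
    | zero => exact hx
    | succ n ih => rw [t1]; exact (hf _ ih).1
  have ht1 : ∀ n, l • t (n + 1) = t n := fun n => by rw [t1]; exact (hf _ (hPt n)).2
  let s : ℕ → M := fun n => Nat.casesOn n 0 t
  have hs : ∀ n, l • s (n + 1) = s n := by
    intro n
    cases n with
    | zero => exact h0
    | succ n => exact ht1 n
  refine ht s ?_ hs 1
  intro n
  induction n with
  | zero => simp [s]
  | succ n ih => rw [pow_succ, mul_smul, hs, ih]

theorem finite_torsion_aux {M : Type*} [AddCommGroup M] (l : ℕ) (hl : 1 ≤ l)
    (ht : ∀ x : ℕ → M,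
      (∀ n : ℕ, (l ^ n) • x n = 0) → (∀ n : ℕ, l • x (n + 1) = x n) → ∀ n, x n = 0)
    (hfin : ∀ n : ℕ, 1 ≤ n → Finite (M ⧸ nsmulSub M n)) :
    {x : M | l • x = 0}.Finite := by
  have key : ∃ N, ∀ k, N ≤ k → ∀ y : M, l • l ^ k • y = 0 → ∃ z, l ^ (k + 1) • z = l ^ k • y := by
    by_contra! hcon
    choose K hK y hy hz using hcon
    have := hfin l hl
    let g' : ℕ → ℕ := fun n => Nat.rec 0 (fun _ m => K m + 1) n
    have gm : StrictMono (fun n => K (g' n)) := by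
      refine strictMono_nat_of_lt_succ fun n => ?_
      have : g' (n + 1) = K (g' n) + 1 := rfl
      have h2 := hK (g' (n + 1))
      omega
    obtain ⟨a, b, hab, he⟩ := Finite.exists_ne_map_eq_of_infinite
      (fun n => (QuotientAddGroup.mk (y (g' n)) : M ⧸ nsmulSub M l))
    have main : ∀ a b, a < b → (QuotientAddGroup.mk (y (g' a)) : M ⧸ nsmulSub M l) =
        QuotientAddGroup.mk (y (g' b)) → False := by
      intro a b hab he
      rw [QuotientAddGroup.eq, mem_nsmulSub_aux] at he
      obtain ⟨z, hzz⟩ := he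
      have hlt : K (g' a) < K (g' b) := gm hab
      apply hz (g' b) z
      obtain ⟨d, hd⟩ := Nat.exists_eq_add_of_lt hlt
      have h0 : l ^ K (g' b) • y (g' a) = 0 := by
        have e : l ^ K (g' b) = l ^ d * (l * l ^ K (g' a)) := by rw [hd]; ring
        rw [e, mul_smul, mul_smul l, hy, smul_zero]
      rw [pow_succ, mul_smul, hzz, smul_add, smul_neg, h0]
      simp
    rcases lt_or_gt_of_ne hab with h | h
    · exact main a b h he
    · exact main b a h he.symm
  obtain ⟨N, hN⟩ := key
  have key2 : ∀ x : M, l • x = 0 → (∃ y, l ^ N • y = x) → ∀ k, ∃ y, l ^ (N + k) • y = x := by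
    intro x hx h k
    induction k with
    | zero => exact h
    | succ k ih =>
      obtain ⟨y, rfl⟩ := ih
      exact hN (N + k) (by omega) y hx
  have hdiv : ∀ x : M, (∀ k, ∃ y, l ^ (N + k) • y = x) →
      ∃ w, (∀ k, ∃ y, l ^ (N + k) • y = w) ∧ l • w = x := by
    intro x hx
    obtain ⟨y, hy⟩ := hx 1
    have h1 : l • l ^ N • y = x := by rw [← hy, ← mul_smul, pow_succ, mul_comm]
    refine ⟨l ^ N • y, ?_, h1⟩
    intro k
    obtain ⟨v, hv⟩ := hx (k + 1)
    have h2 : l • l ^ (N + k) • v = x := by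
      rw [← hv, ← mul_smul, ← add_assoc, pow_succ _ (N + k), mul_comm]
    obtain ⟨u, hu⟩ := key2 (l ^ N • y - l ^ (N + k) • v) (by rw [smul_sub, h1, h2, sub_self])
      ⟨y - l ^ k • v, by rw [smul_sub, ← mul_smul, ← pow_add]⟩ k
    exact ⟨u + v, by rw [smul_add, hu]; abel⟩
  have hzero : ∀ x : M, l • x = 0 → (∃ y, l ^ N • y = x) → x = 0 := fun x hx h =>
    tate_aux l ht (fun x => ∀ k, ∃ y, l ^ (N + k) • y = x) hdiv x (key2 x hx h) hx
  have := hfin (l ^ N) (Nat.one_le_pow _ _ hl)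
  refine Set.Finite.of_finite_image
    (f := fun x => (QuotientAddGroup.mk x : M ⧸ nsmulSub M (l ^ N))) (Set.toFinite _) ?_
  intro a ha b hb hab
  have ha' : l • a = 0 := ha
  have hb' : l • b = 0 := hb
  have hab' := (QuotientAddGroup.eq).1 hab
  rw [mem_nsmulSub_aux] at hab'
  have := hzero (-a + b) (by rw [smul_add, smul_neg, ha', hb']; simp) hab'
  exact (neg_add_eq_zero.1 this)

theorem ulm_div_aux {M : Type*} [AddCommGroup M] (l : ℕ) (hl : 1 ≤ l)
    (hf : {x : M | l • x = 0}.Finite) (x : M) (hx : x ∈ ulmSub M) :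
    ∃ y ∈ ulmSub M, l • y = x := by
  by_contra! hcon
  have hx' := mem_ulmSub_aux.1 hx
  obtain ⟨y0, hy0⟩ := hx' l hl
  have hF : {y : M | l • y = x}.Finite := by
    refine (hf.image (fun t => t + y0)).subset ?_
    intro y hy
    have hy' : l • y = x := hy
    exact ⟨y - y0, by simp [smul_sub, hy', hy0], by simp⟩
  have h : ∀ y : M, l • y = x → ∃ m : ℕ, 1 ≤ m ∧ ∀ z, m • z ≠ y := by
    intro y hy
    by_contra! hc
    exact hcon y (mem_ulmSub_aux.2 hc) hy
  choose! m hm1 hm2 using h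
  have hp : 1 ≤ ∏ y ∈ hF.toFinset, m y := by
    refine Nat.one_le_iff_ne_zero.2 (Finset.prod_ne_zero_iff.2 fun y hy => ?_)
    exact Nat.one_le_iff_ne_zero.1 (hm1 y (by simpa using hy))
  obtain ⟨v, hv⟩ := hx' (l * ∏ y ∈ hF.toFinset, m y) (Nat.mul_pos hl hp)
  rw [mul_smul] at hv
  obtain ⟨c, hc⟩ := Finset.dvd_prod_of_mem m
    (show (∏ y ∈ hF.toFinset, m y) • v ∈ hF.toFinset by simpa using hv)
  refine hm2 _ hv (c • v) ?_
  rw [← mul_smul, ← hc]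

/-- Let `M` be an abelian group whose `ℓ`-adic Tate module
`T_ℓ M = lim_n Ker(ℓⁿ : M → M)` vanishes for every prime `ℓ` (an element of `T_ℓ M` is a
sequence `x : ℕ → M` with `ℓⁿ • x n = 0` and `ℓ • x (n+1) = x n`), and such that `M/nM`
is finite for every `n ≥ 1`.  Then the first Ulm subgroup `U(M) = ⋂_{n≥1} nM` is uniquely
divisible: it is divisible and torsion-free. -/
theorem ulm_uniquely_divisible_of_tate_modules_vanish
    (M : Type*) [AddCommGroup M]
    (htate : ∀ ℓ : ℕ, ℓ.Prime → ∀ x : ℕ → M,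
      (∀ n : ℕ, (ℓ ^ n) • x n = 0) → (∀ n : ℕ, ℓ • x (n + 1) = x n) → ∀ n, x n = 0)
    (hfin : ∀ n : ℕ, 1 ≤ n → Finite (M ⧸ nsmulSub M n)) :
    (∀ n : ℕ, 1 ≤ n → ∀ x ∈ ulmSub M, ∃ y ∈ ulmSub M, n • y = x) ∧
      (∀ x ∈ ulmSub M, ∀ n : ℕ, 1 ≤ n → n • x = 0 → x = 0) := by
  have hdp : ∀ l : ℕ, l.Prime → ∀ x ∈ ulmSub M, ∃ y ∈ ulmSub M, l • y = x := fun l hl =>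
    ulm_div_aux l hl.one_le (finite_torsion_aux l hl.one_le (htate l hl) hfin)
  have htp : ∀ l : ℕ, l.Prime → ∀ x ∈ ulmSub M, l • x = 0 → x = 0 := fun l hl x hx h0 =>
    tate_aux l (htate l hl) (fun x => x ∈ ulmSub M) (fun x hx => hdp l hl x hx) x hx h0
  constructor
  · intro n
    induction n using induction_on_primes with
    | zero => intro h; omega
    | one => intro _ x hx; exact ⟨x, hx, one_smul _ _⟩
    | prime_mul p a hp ih =>
      intro h x hx
      obtain ⟨y, hy, rfl⟩ := hdp p hp x hx
      obtain ⟨z, hz, rfl⟩ := ih (Nat.pos_of_mul_pos_left h) y hy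
      exact ⟨z, hz, mul_smul _ _ _⟩
  · intro x hx n
    induction n using induction_on_primes with
    | zero => intro h; omega
    | one => intro _ h; simpa using h
    | prime_mul p a hp ih =>
      intro h h0
      rw [mul_smul] at h0
      exact ih (Nat.pos_of_mul_pos_left h) (htp p hp _ ((ulmSub M).nsmul_mem hx a) h0)
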